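/- Let A be a Banach algebra with a bounded approximate identity that is a two-sided ideal in its bidual A**, and let J be a small-1-1 closed ideal of A. Then J**J** ⊆ Z₁(J**) (first Arens product) and J**◊J** ⊆ Z₂(J**) (second Arens product). If in addition A is weakly sequentially complete, then J is strongly Arens irregular if and only if J is reflexive. -/

import Mathlib

noncomputable section

open Filter Topology

section ArensSetup

variable (A : Type*) [NonUnitalNormedRing A] [NormedSpace ℂ A]
  [IsScalarTower ℂ A A] [SMulCommClass ℂ A A]

/-- The module action `φ · a` of `A` on `A*`: `⟨φ · a, b⟩ = ⟨φ, a * b⟩`. -/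
def dArR (φ : A →L[ℂ] ℂ) (a : A) : A →L[ℂ] ℂ :=
  φ.comp (ContinuousLinearMap.mul ℂ A a)

/-- The module action `a · φ` of `A` on `A*`: `⟨a · φ, b⟩ = ⟨φ, b * a⟩`. -/
def dArL (a : A) (φ : A →L[ℂ] ℂ) : A →L[ℂ] ℂ :=
  φ.comp ((ContinuousLinearMap.mul ℂ A).flip a)

/-- `φ ↦ (a ↦ φ · a)`, bundled as a continuous linear map. -/
def dArRL : (A →L[ℂ] ℂ) →L[ℂ] A →L[ℂ] A →L[ℂ] ℂ :=
  ((ContinuousLinearMap.compL ℂ A (A →L[ℂ] A) (A →L[ℂ] ℂ)).flip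
      (ContinuousLinearMap.mul ℂ A)).comp (ContinuousLinearMap.compL ℂ A A ℂ)

/-- `φ ↦ (a ↦ a · φ)`, bundled as a continuous linear map. -/
def dArLL : (A →L[ℂ] ℂ) →L[ℂ] A →L[ℂ] A →L[ℂ] ℂ :=
  ((ContinuousLinearMap.compL ℂ A (A →L[ℂ] A) (A →L[ℂ] ℂ)).flip
      ((ContinuousLinearMap.mul ℂ A).flip)).comp (ContinuousLinearMap.compL ℂ A A ℂ)

/-- The module action `m · φ` of `A**` on `A*`: `⟨m · φ, a⟩ = ⟨m, φ · a⟩`. -/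
def bdF (m : (A →L[ℂ] ℂ) →L[ℂ] ℂ) (φ : A →L[ℂ] ℂ) : A →L[ℂ] ℂ :=
  m.comp (dArRL A φ)

/-- The module action `φ · m` of `A**` on `A*`: `⟨φ · m, a⟩ = ⟨m, a · φ⟩`. -/
def fBd (φ : A →L[ℂ] ℂ) (m : (A →L[ℂ] ℂ) →L[ℂ] ℂ) : A →L[ℂ] ℂ :=
  m.comp (dArLL A φ)

/-- The first Arens product on `A**`: `⟨m n, φ⟩ = ⟨m, n · φ⟩`. -/
def ar1 (m n : (A →L[ℂ] ℂ) →L[ℂ] ℂ) : (A →L[ℂ] ℂ) →L[ℂ] ℂ :=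
  m.comp ((ContinuousLinearMap.compL ℂ A (A →L[ℂ] ℂ) ℂ n).comp (dArRL A))

/-- The second Arens product on `A**`: `⟨m ◊ n, φ⟩ = ⟨n, φ · m⟩`. -/
def ar2 (m n : (A →L[ℂ] ℂ) →L[ℂ] ℂ) : (A →L[ℂ] ℂ) →L[ℂ] ℂ :=
  n.comp ((ContinuousLinearMap.compL ℂ A (A →L[ℂ] ℂ) ℂ m).comp (dArLL A))

/-- The canonical embedding of `A` into its bidual. -/
def ιA : A →L[ℂ] ((A →L[ℂ] ℂ) →L[ℂ] ℂ) := ContinuousLinearMap.apply ℂ ℂ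

/-- The set of weakly almost periodic functionals: those `φ ∈ A*` for which `a ↦ a · φ`
is a weakly compact operator from `A` to `A*`. -/
def WAPset : Set (A →L[ℂ] ℂ) :=
  {φ | IsCompact (closure
    ((fun a : A => (show WeakSpace ℂ (A →L[ℂ] ℂ) from dArL A a φ)) '' Metric.closedBall 0 1))}

/-- `u` is a bounded (two-sided) approximate identity along the filter `l`. -/
def IsBAIFor {ιt : Type*} (l : Filter ιt) (u : ιt → A) : Prop :=
  l.NeBot ∧ Bornology.IsBounded (Set.range u) ∧
    (∀ a : A, Tendsto (fun i => a * u i) l (𝓝 a)) ∧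
    (∀ a : A, Tendsto (fun i => u i * a) l (𝓝 a))

/-- `A` has a bounded approximate identity. -/
def HasBAI : Prop := ∃ (ιt : Type) (l : Filter ιt) (u : ιt → A), IsBAIFor A l u

/-- A mixed identity of `A**`: a right identity for the first Arens product and a left
identity for the second Arens product. -/
def IsMixedIdentity (e : (A →L[ℂ] ℂ) →L[ℂ] ℂ) : Prop :=
  (∀ m, ar1 A m e = m) ∧ (∀ m, ar2 A e m = m)

/-- `A` is a two-sided ideal in its bidual (with the first Arens product). -/
def IdealInBidual : Prop :=
  ∀ (m : (A →L[ℂ] ℂ) →L[ℂ] ℂ) (a : A),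
    ar1 A m (ιA A a) ∈ Set.range (ιA A) ∧ ar1 A (ιA A a) m ∈ Set.range (ιA A)

/-- `A` is weakly sequentially complete. -/
def WeaklySequentiallyComplete : Prop :=
  ∀ x : ℕ → A, (∀ φ : A →L[ℂ] ℂ, ∃ z : ℂ, Tendsto (fun n => φ (x n)) atTop (𝓝 z)) →
    ∃ a : A, ∀ φ : A →L[ℂ] ℂ, Tendsto (fun n => φ (x n)) atTop (𝓝 (φ a))

/-- The wsaBAI class: weakly sequentially complete, with a bounded approximate identity,
and an ideal in its bidual. -/
def IsWSABAI : Prop :=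
  WeaklySequentiallyComplete A ∧ HasBAI A ∧ IdealInBidual A

/-- `J` is a closed two-sided ideal of `A`. -/
def IsClosedIdeal (J : Submodule ℂ A) : Prop :=
  IsClosed (J : Set A) ∧ (∀ b : A, ∀ a ∈ J, b * a ∈ J) ∧ (∀ b : A, ∀ a ∈ J, a * b ∈ J)

/-- The canonical image `J^{⊥⊥}` of `J**` inside `A**`.  For a closed ideal `J` this
realizes the bidual of `J` (with its Arens products) inside `A**`. -/
def bidualOf (J : Submodule ℂ A) : Set ((A →L[ℂ] ℂ) →L[ℂ] ℂ) :=
  {s | ∀ φ : A →L[ℂ] ℂ, (∀ a ∈ J, φ a = 0) → s φ = 0}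

/-- The first topological centre of a subset of `A**` (e.g. of `J** = bidualOf A J`). -/
def Z1in (S : Set ((A →L[ℂ] ℂ) →L[ℂ] ℂ)) : Set ((A →L[ℂ] ℂ) →L[ℂ] ℂ) :=
  {m ∈ S | ∀ n ∈ S, ar1 A m n = ar2 A m n}

/-- The second topological centre of a subset of `A**`. -/
def Z2in (S : Set ((A →L[ℂ] ℂ) →L[ℂ] ℂ)) : Set ((A →L[ℂ] ℂ) →L[ℂ] ℂ) :=
  {m ∈ S | ∀ n ∈ S, ar1 A n m = ar2 A n m}

/-- The restriction map `i* : A* → J*` adjoint to the inclusion `i : J → A`. -/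
def iStar (J : Submodule ℂ A) : (A →L[ℂ] ℂ) →L[ℂ] (↥J →L[ℂ] ℂ) :=
  (ContinuousLinearMap.compL ℂ ↥J A ℂ).flip J.subtypeL

/-- `i*(WAP(A))^⊥ = {r ∈ J** : ⟨r, i*(φ)⟩ = 0 for all φ ∈ WAP(A)}`, realized inside `A**`. -/
def wapPerp (J : Submodule ℂ A) : Set ((A →L[ℂ] ℂ) →L[ℂ] ℂ) :=
  {r ∈ bidualOf A J | ∀ φ ∈ WAPset A, r φ = 0}

/-- `J` is a weak Riesz ideal: `J** · J* ∪ J* · J**` is contained in the norm closure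
of `i*(WAP(A))` in `J*`. -/
def WeakRiesz (J : Submodule ℂ A) : Prop :=
  ∀ m ∈ bidualOf A J, ∀ ψ : A →L[ℂ] ℂ,
    iStar A J (bdF A m ψ) ∈ closure (iStar A J '' WAPset A) ∧
    iStar A J (fBd A ψ m) ∈ closure (iStar A J '' WAPset A)

/-- `J` is a small-1-1 ideal: `e J** J** ⊆ J`. -/
def Small11 (J : Submodule ℂ A) (e : (A →L[ℂ] ℂ) →L[ℂ] ℂ) : Prop :=
  ∀ m ∈ bidualOf A J, ∀ n ∈ bidualOf A J,
    ar1 A e (ar1 A m n) ∈ ιA A '' (J : Set A)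

/-- `J` is a Riesz ideal: `e J** = J** ◊ e = J`. -/
def RieszIdeal (J : Submodule ℂ A) (e : (A →L[ℂ] ℂ) →L[ℂ] ℂ) : Prop :=
  {s | ∃ m ∈ bidualOf A J, s = ar1 A e m} = ιA A '' (J : Set A) ∧
  {s | ∃ m ∈ bidualOf A J, s = ar2 A m e} = ιA A '' (J : Set A)

/-- `J` has a bounded approximate identity (as a Banach algebra in its own right). -/
def HasBAIinIdeal (J : Submodule ℂ A) : Prop :=
  ∃ (ιt : Type) (l : Filter ιt) (u : ιt → A), l.NeBot ∧ Bornology.IsBounded (Set.range u) ∧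
    (∀ i, u i ∈ J) ∧ (∀ a ∈ J, Tendsto (fun i => a * u i) l (𝓝 a)) ∧
    (∀ a ∈ J, Tendsto (fun i => u i * a) l (𝓝 a))

/-- `WAP(J)` as a subset of `J*`: those `ξ ∈ J*` such that `b ↦ b · ξ` is a weakly
compact operator from `J` to `J*`.  The action is computed through any Hahn–Banach
extension `ψ ∈ A*` of `ξ` (for an ideal `J` the result does not depend on the extension). -/
def WAPJ (J : Submodule ℂ A) : Set (↥J →L[ℂ] ℂ) :=
  {ξ | ∃ ψ : A →L[ℂ] ℂ, iStar A J ψ = ξ ∧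
    IsCompact (closure
      ((fun b : ↥J => (show WeakSpace ℂ (↥J →L[ℂ] ℂ) from iStar A J (dArL A (b : A) ψ))) ''
        Metric.closedBall 0 1))}

end ArensSetup

theorem ιA_apply {A : Type*} [NonUnitalNormedRing A] [NormedSpace ℂ A] (a : A) (φ : A →L[ℂ] ℂ) :
    ιA A a φ = φ a := rfl

section ArensProducts

variable {A : Type*} [NonUnitalNormedRing A] [NormedSpace ℂ A]
  [IsScalarTower ℂ A A] [SMulCommClass ℂ A A]

theorem ar1_apply (m n : (A →L[ℂ] ℂ) →L[ℂ] ℂ) (φ : A →L[ℂ] ℂ) :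
    ar1 A m n φ = m (bdF A n φ) := rfl

theorem ar2_apply (m n : (A →L[ℂ] ℂ) →L[ℂ] ℂ) (φ : A →L[ℂ] ℂ) :
    ar2 A m n φ = n (fBd A φ m) := rfl

theorem bdF_apply (m : (A →L[ℂ] ℂ) →L[ℂ] ℂ) (φ : A →L[ℂ] ℂ) (a : A) :
    bdF A m φ a = m (dArR A φ a) := rfl

theorem fBd_apply (m : (A →L[ℂ] ℂ) →L[ℂ] ℂ) (φ : A →L[ℂ] ℂ) (a : A) :
    fBd A φ m a = m (dArL A a φ) := rfl

theorem dArR_apply (φ : A →L[ℂ] ℂ) (a b : A) : dArR A φ a b = φ (a * b) := rfl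

theorem dArL_apply (φ : A →L[ℂ] ℂ) (a b : A) : dArL A a φ b = φ (b * a) := rfl

theorem bdF_dArR (m : (A →L[ℂ] ℂ) →L[ℂ] ℂ) (φ : A →L[ℂ] ℂ) (a : A) :
    bdF A m (dArR A φ a) = dArR A (bdF A m φ) a := by
  ext b
  rw [bdF_apply, dArR_apply, bdF_apply]
  congr 1
  ext c
  simp only [dArR_apply, mul_assoc]

theorem fBd_dArL (m : (A →L[ℂ] ℂ) →L[ℂ] ℂ) (φ : A →L[ℂ] ℂ) (a : A) :
    fBd A (dArL A a φ) m = dArL A a (fBd A φ m) := by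
  ext b
  rw [fBd_apply, dArL_apply, fBd_apply]
  congr 1
  ext c
  simp only [dArL_apply, mul_assoc]

theorem bdF_ι (φ : A →L[ℂ] ℂ) (a : A) : bdF A (ιA A a) φ = dArL A a φ := by
  ext b
  rw [bdF_apply, ιA_apply, dArR_apply, dArL_apply]

theorem fBd_ι (φ : A →L[ℂ] ℂ) (a : A) : fBd A φ (ιA A a) = dArR A φ a := by
  ext b
  rw [fBd_apply, ιA_apply, dArR_apply, dArL_apply]

theorem ar1_assoc (m n p : (A →L[ℂ] ℂ) →L[ℂ] ℂ) :
    ar1 A (ar1 A m n) p = ar1 A m (ar1 A n p) := by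
  ext φ
  rw [ar1_apply, ar1_apply, ar1_apply]
  congr 1
  ext a
  rw [bdF_apply, bdF_apply, ar1_apply, bdF_dArR]

theorem ar2_assoc (m n p : (A →L[ℂ] ℂ) →L[ℂ] ℂ) :
    ar2 A (ar2 A m n) p = ar2 A m (ar2 A n p) := by
  ext φ
  rw [ar2_apply, ar2_apply, ar2_apply]
  congr 1
  ext a
  rw [fBd_apply, fBd_apply, ar2_apply, fBd_dArL]

/-- The two Arens products agree when the left factor lies in `A`. -/
theorem ar1_ι_left (a : A) (n : (A →L[ℂ] ℂ) →L[ℂ] ℂ) :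
    ar1 A (ιA A a) n = ar2 A (ιA A a) n := by
  ext φ
  rw [ar1_apply, ar2_apply, fBd_ι, ιA_apply, bdF_apply]

/-- The two Arens products agree when the right factor lies in `A`. -/
theorem ar1_ι_right (m : (A →L[ℂ] ℂ) →L[ℂ] ℂ) (a : A) :
    ar1 A m (ιA A a) = ar2 A m (ιA A a) := by
  ext φ
  rw [ar1_apply, ar2_apply, bdF_ι, ιA_apply, fBd_apply]

/-- Left multiplication by `A` determines left multiplication by `A**` (first product). -/
theorem ar1_congr_right {m n : (A →L[ℂ] ℂ) →L[ℂ] ℂ}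
    (h : ∀ a : A, ar1 A (ιA A a) m = ar1 A (ιA A a) n) (p : (A →L[ℂ] ℂ) →L[ℂ] ℂ) :
    ar1 A p m = ar1 A p n := by
  ext φ
  rw [ar1_apply, ar1_apply]
  congr 1
  ext a
  rw [← ιA_apply a, ← ιA_apply a, ← ar1_apply, ← ar1_apply, h]

/-- Right multiplication by `A` determines right multiplication by `A**` (second product). -/
theorem ar2_congr_left {m n : (A →L[ℂ] ℂ) →L[ℂ] ℂ}
    (h : ∀ a : A, ar1 A m (ιA A a) = ar1 A n (ιA A a)) (p : (A →L[ℂ] ℂ) →L[ℂ] ℂ) :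
    ar2 A m p = ar2 A n p := by
  ext φ
  rw [ar2_apply, ar2_apply]
  congr 1
  ext a
  rw [← ιA_apply a, ← ιA_apply a, ← ar2_apply, ← ar2_apply, ← ar1_ι_right, ← ar1_ι_right, h]

theorem IsMixedIdentity.ar1_ι {e : (A →L[ℂ] ℂ) →L[ℂ] ℂ} (he : IsMixedIdentity A e) (a : A) :
    ar1 A e (ιA A a) = ιA A a := by
  rw [ar1_ι_right, he.2]

theorem IsMixedIdentity.cancel_left {e : (A →L[ℂ] ℂ) →L[ℂ] ℂ} (he : IsMixedIdentity A e)
    {x y : A} (h : ∀ a : A, ar1 A (ιA A a) (ιA A x) = ar1 A (ιA A a) (ιA A y)) :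
    ιA A x = ιA A y := by
  rw [← he.ar1_ι x, ← he.ar1_ι y, ar1_congr_right h]

theorem IsMixedIdentity.cancel_right {e : (A →L[ℂ] ℂ) →L[ℂ] ℂ} (he : IsMixedIdentity A e)
    {x y : A} (h : ∀ a : A, ar1 A (ιA A x) (ιA A a) = ar1 A (ιA A y) (ιA A a)) :
    ιA A x = ιA A y := by
  rw [← he.1 (ιA A x), ← he.1 (ιA A y), ar1_ι_left, ar1_ι_left, ar2_congr_left h]

/-- `m ∈ A**` and `c ∈ A` induce the same left and right multiplications on `A`. -/
def ActsAs (m : (A →L[ℂ] ℂ) →L[ℂ] ℂ) (c : A) : Prop :=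
  (∀ a : A, ar1 A (ιA A a) m = ar1 A (ιA A a) (ιA A c)) ∧
    ∀ a : A, ar1 A m (ιA A a) = ar1 A (ιA A c) (ιA A a)

theorem ActsAs.eq_ι {e m : (A →L[ℂ] ℂ) →L[ℂ] ℂ} {c : A} (hm : ActsAs m c)
    (he : IsMixedIdentity A e) (hmA : m ∈ Set.range (ιA A)) : m = ιA A c := by
  obtain ⟨x, rfl⟩ := hmA
  exact he.cancel_left hm.1

theorem Small11.exists_actsAs {J : Submodule ℂ A} {e : (A →L[ℂ] ℂ) →L[ℂ] ℂ}
    (hs : Small11 A J e) (hIdeal : IdealInBidual A) (he : IsMixedIdentity A e)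
    {m n : (A →L[ℂ] ℂ) →L[ℂ] ℂ} (hm : m ∈ bidualOf A J) (hn : n ∈ bidualOf A J) :
    ∃ c : A, ActsAs (ar1 A m n) c ∧ ActsAs (ar2 A m n) c := by
  obtain ⟨c, -, hc⟩ := hs m hm n hn
  have h₁ : ActsAs (ar1 A m n) c := by
    refine ⟨fun a => ?_, fun a => ?_⟩
    · rw [hc, ← ar1_assoc _ e, he.1]
    · obtain ⟨x, hx⟩ := (hIdeal n a).1
      obtain ⟨y, hy⟩ := (hIdeal m x).1
      rw [hc, ar1_assoc e, ar1_assoc m, ← hx, ← hy, he.ar1_ι]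
  refine ⟨c, h₁, fun a => ?_, fun a => ?_⟩
  · obtain ⟨x, hx⟩ := (hIdeal m a).2
    rw [← h₁.1, ar1_ι_left, ← ar2_assoc, ← ar1_ι_left, ← ar1_assoc, ← hx, ar1_ι_left]
  · obtain ⟨x, hx⟩ := (hIdeal n a).1
    rw [← h₁.2, ar1_ι_right, ar2_assoc, ← ar1_ι_right, ar1_assoc, ← hx, ar1_ι_right]

theorem ar1_mem_bidualOf {J : Submodule ℂ A} (hJ : IsClosedIdeal A J)
    {m n : (A →L[ℂ] ℂ) →L[ℂ] ℂ} (hm : m ∈ bidualOf A J) (hn : n ∈ bidualOf A J) :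
    ar1 A m n ∈ bidualOf A J :=
  fun φ hφ => hm (bdF A n φ) fun a ha =>
    hn (dArR A φ a) fun b _ => hφ _ (hJ.2.2 b a ha)

theorem ar2_mem_bidualOf {J : Submodule ℂ A} (hJ : IsClosedIdeal A J)
    {m n : (A →L[ℂ] ℂ) →L[ℂ] ℂ} (hm : m ∈ bidualOf A J) (hn : n ∈ bidualOf A J) :
    ar2 A m n ∈ bidualOf A J :=
  fun φ hφ => hn (fBd A φ m) fun a ha =>
    hm (dArL A a φ) fun b _ => hφ _ (hJ.2.1 b a ha)

theorem Small11.ar1_mem_Z1in {J : Submodule ℂ A} {e : (A →L[ℂ] ℂ) →L[ℂ] ℂ}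
    (hs : Small11 A J e) (hJ : IsClosedIdeal A J) (hIdeal : IdealInBidual A)
    (he : IsMixedIdentity A e) {m n : (A →L[ℂ] ℂ) →L[ℂ] ℂ}
    (hm : m ∈ bidualOf A J) (hn : n ∈ bidualOf A J) :
    ar1 A m n ∈ Z1in A (bidualOf A J) := by
  refine ⟨ar1_mem_bidualOf hJ hm hn, fun p hp => ?_⟩
  obtain ⟨c, hc, -⟩ := hs.exists_actsAs hIdeal he hm hn
  obtain ⟨d, hd, -⟩ := hs.exists_actsAs hIdeal he hn hp
  have hcp : ar2 A (ar1 A m n) p = ar1 A (ιA A c) p := by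
    rw [ar2_congr_left hc.2, ar1_ι_left]
  have hmd : ar1 A (ar1 A m n) p = ar1 A m (ιA A d) := by
    rw [ar1_assoc, ar1_congr_right hd.1]
  obtain ⟨x, hx⟩ := (hIdeal p c).2
  obtain ⟨y, hy⟩ := (hIdeal m d).1
  rw [hmd, hcp, ← hx, ← hy]
  refine he.cancel_left fun a => ?_
  rw [hx, hy, ← hmd, ← ar1_assoc, hc.1, ar1_assoc]

theorem Small11.ar2_mem_Z2in {J : Submodule ℂ A} {e : (A →L[ℂ] ℂ) →L[ℂ] ℂ}
    (hs : Small11 A J e) (hJ : IsClosedIdeal A J) (hIdeal : IdealInBidual A)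
    (he : IsMixedIdentity A e) {m n : (A →L[ℂ] ℂ) →L[ℂ] ℂ}
    (hm : m ∈ bidualOf A J) (hn : n ∈ bidualOf A J) :
    ar2 A m n ∈ Z2in A (bidualOf A J) := by
  refine ⟨ar2_mem_bidualOf hJ hm hn, fun p hp => ?_⟩
  obtain ⟨c, -, hc⟩ := hs.exists_actsAs hIdeal he hm hn
  obtain ⟨d, -, hd⟩ := hs.exists_actsAs hIdeal he hp hm
  have hpc : ar1 A p (ar2 A m n) = ar1 A p (ιA A c) := ar1_congr_right hc.1 p
  have hdn : ar2 A p (ar2 A m n) = ar1 A (ιA A d) n := by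
    rw [← ar2_assoc, ar2_congr_left hd.2, ar1_ι_left]
  obtain ⟨x, hx⟩ := (hIdeal p c).1
  obtain ⟨y, hy⟩ := (hIdeal n d).2
  rw [hpc, hdn, ← hx, ← hy]
  refine he.cancel_right fun a => ?_
  obtain ⟨z, hz⟩ := (hIdeal (ιA A c) a).1
  rw [hx, hy, ← hdn, ar1_assoc, ar1_ι_right (ar2 A p (ar2 A m n)), ar2_assoc p,
    ← ar1_ι_right (ar2 A m n), hc.2, ← hz, ar1_ι_right]

end ArensProducts

/-- Let `A` be a Banach algebra with a bounded approximate identity that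
is a two-sided ideal in its bidual, and let `J` be a small-1-1 closed ideal of `A`.  Then
`J** J** ⊆ Z₁(J**)` and `J** ◊ J** ⊆ Z₂(J**)`.  If in addition `A` is weakly sequentially
complete, then `J` is strongly Arens irregular if and only if `J` is reflexive (i.e.
`J** = ι(J)` inside `A**`). -/
theorem statement6 (A : Type*) [NonUnitalNormedRing A] [NormedSpace ℂ A]
    [IsScalarTower ℂ A A] [SMulCommClass ℂ A A] [CompleteSpace A]
    (hBAI : HasBAI A) (hIdeal : IdealInBidual A)
    (J : Submodule ℂ A) (hJ : IsClosedIdeal A J)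
    (e : (A →L[ℂ] ℂ) →L[ℂ] ℂ) (he : IsMixedIdentity A e)
    (hs : Small11 A J e) :
    (∀ m ∈ bidualOf A J, ∀ n ∈ bidualOf A J,
      ar1 A m n ∈ Z1in A (bidualOf A J) ∧ ar2 A m n ∈ Z2in A (bidualOf A J)) ∧
    (WeaklySequentiallyComplete A →
      ((Z1in A (bidualOf A J) = ιA A '' (J : Set A) ∧
        Z2in A (bidualOf A J) = ιA A '' (J : Set A)) ↔
       bidualOf A J = ιA A '' (J : Set A))) := by
  refine ⟨fun m hm n hn => ⟨hs.ar1_mem_Z1in hJ hIdeal he hm hn,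
    hs.ar2_mem_Z2in hJ hIdeal he hm hn⟩, fun _ => ⟨fun ⟨h₁, h₂⟩ => ?_, fun h => ?_⟩⟩
  · rw [← h₁]
    refine Set.Subset.antisymm (fun m hm => ⟨hm, fun n hn => ?_⟩) (Set.sep_subset _ _)
    obtain ⟨c, hc₁, hc₂⟩ := hs.exists_actsAs hIdeal he hm hn
    have hm₁ := hs.ar1_mem_Z1in hJ hIdeal he hm hn
    have hm₂ := hs.ar2_mem_Z2in hJ hIdeal he hm hn
    rw [h₁] at hm₁
    rw [h₂] at hm₂
    rw [hc₁.eq_ι he (Set.image_subset_range _ _ hm₁),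
      hc₂.eq_ι he (Set.image_subset_range _ _ hm₂)]
  · rw [h]
    constructor
    · refine Set.Subset.antisymm (Set.sep_subset _ _) fun m hm => ⟨hm, fun n _ => ?_⟩
      obtain ⟨a, -, rfl⟩ := hm
      exact ar1_ι_left a n
    · refine Set.Subset.antisymm (Set.sep_subset _ _) fun m hm => ⟨hm, fun n _ => ?_⟩
      obtain ⟨a, -, rfl⟩ := hm
      exact ar1_ι_right n a
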